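/- Let α ∈ (0,1), σ = 1 − α/2, T > 0, and let λ : [0,T] → ℝ be twice continuously differentiable with λ > 0 and λ' ≤ 0. Let k, q : [0,T] → ℝ be continuous with 0 < c₁ ≤ k(t) ≤ c₂ and q(t) ≥ 0. Let N ≥ 2, M ≥ 1 be integers, h = 1/N, τ = T/M, t_{j+σ} = (j+σ)τ. Define the averaging operator (H_h v)_i = v_i + h² (v_{i+1} − 2v_i + v_{i−1})/(12 h²) = (v_{i−1} + 10 v_i + v_{i+1})/12 for 1 ≤ i ≤ N−1. Suppose the grid functions y^0, …, y^M : {0,…,N} → ℝ with y_0^j = y_N^j = 0 and right-hand sides φ^{j+σ} satisfy, for all 0 ≤ j ≤ M−1 and 1 ≤ i ≤ N−1, (τ^{1−α}/Γ(2−α)) Σ_{s=0}^{j} c_{j−s}^{(α)} ((H_h y^{s+1})_i − (H_h y^s)_i)/τ = k(t_{j+σ}) (y_{i+1}^{(σ)} − 2 y_i^{(σ)} + y_{i−1}^{(σ)})/h² − q(t_{j+σ}) (H_h y^{(σ)})_i + (H_h φ^{j+σ})_i, where y^{(σ)} = σ y^{j+1} + (1−σ) y^j. Then for every 0 ≤ j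 ≤ M−1, ‖H_h y^{j+1}‖₀² ≤ ‖H_h y^0‖₀² + (T^α Γ(1−α)/(λ(T) c₁)) · max_{0 ≤ m ≤ M−1} ‖H_h φ^{m+σ}‖₀². -/

import Mathlib

/-- `a_l^{(α)}`: `a_0 = σ^{1−α}`, `a_l = (l+σ)^{1−α} − (l−1+σ)^{1−α}` for `l ≥ 1`. -/
noncomputable def aCoef (α σ : ℝ) (l : ℕ) : ℝ :=
  if l = 0 then σ ^ (1 - α)
  else ((l : ℝ) + σ) ^ (1 - α) - ((l : ℝ) - 1 + σ) ^ (1 - α)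

/-- `b_l^{(α)} = ((l+σ)^{2−α} − (l−1+σ)^{2−α})/(2−α) − ((l+σ)^{1−α} + (l−1+σ)^{1−α})/2` for `l ≥ 1`. -/
noncomputable def bCoef (α σ : ℝ) (l : ℕ) : ℝ :=
  (((l : ℝ) + σ) ^ (2 - α) - ((l : ℝ) - 1 + σ) ^ (2 - α)) / (2 - α) -
    (((l : ℝ) + σ) ^ (1 - α) + ((l : ℝ) - 1 + σ) ^ (1 - α)) / 2

/-- `c_s^{(α)}` for the `_λ`L2-1`_σ` formula at the level `j`, with weight `λ` sampled at
multiples of the time step `τ` (`λ_r = λ(rτ)`):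
if `j = 0`, `c_0 = λ_{σ−1/2} a_0`; if `j ≥ 1`, `c_0 = λ_{σ−1/2} a_0 + λ_σ b_1`,
`c_s = λ_{s+σ−1/2} a_s + λ_{s+σ} b_{s+1} − λ_{s+σ} b_s` for `1 ≤ s ≤ j−1`, and
`c_j = λ_{j+σ−1/2} a_j − λ_{j+σ} b_j`. -/
noncomputable def cCoef (α σ τ : ℝ) (lam : ℝ → ℝ) (j s : ℕ) : ℝ :=
  if j = 0 then lam ((σ - 1 / 2) * τ) * aCoef α σ 0
  else if s = 0 then lam ((σ - 1 / 2) * τ) * aCoef α σ 0 + lam (σ * τ) * bCoef α σ 1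
  else if s = j then
    lam (((j : ℝ) + σ - 1 / 2) * τ) * aCoef α σ j - lam (((j : ℝ) + σ) * τ) * bCoef α σ j
  else
    lam (((s : ℝ) + σ - 1 / 2) * τ) * aCoef α σ s + lam (((s : ℝ) + σ) * τ) * bCoef α σ (s + 1) -
      lam (((s : ℝ) + σ) * τ) * bCoef α σ s

/-- Grid inner product `(y, v) = Σ_{i=1}^{N−1} y_i v_i h` with `h = 1/N`. -/
noncomputable def gridInner (N : ℕ) (y v : ℕ → ℝ) : ℝ :=
  ∑ i ∈ Finset.Ioo 0 N, y i * v i * (1 / (N : ℝ))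

/-- The compact averaging operator `(H_h v)_i = (v_{i−1} + 10 v_i + v_{i+1})/12`. -/
noncomputable def Hh (v : ℕ → ℝ) (i : ℕ) : ℝ :=
  (v (i - 1) + 10 * v i + v (i + 1)) / 12

open Finset

lemma sub_le_average_of_convexOn_deriv {F g : ℝ → ℝ} {x : ℝ}
    (hF : ∀ t ∈ Set.Icc x (x + 1), HasDerivAt F (g t) t) (hg : ConvexOn ℝ (Set.Icc x (x + 1)) g) :
    F (x + 1) - F x ≤ (g x + g (x + 1)) / 2 := by
  let B : ℝ → ℝ := fun t => F x + (t - x) * g x + (t - x) ^ 2 / 2 * (g (x + 1) - g x)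
  have hB : ∀ t, HasDerivAt B (g x + (t - x) * (g (x + 1) - g x)) t := by
    intro t
    have h1 : HasDerivAt (fun t : ℝ => t - x) 1 t := (hasDerivAt_id t).sub_const x
    have h2 := ((h1.mul_const (g x)).const_add (F x)).add
      (((h1.pow 2).div_const 2).mul_const (g (x + 1) - g x))
    exact h2.congr_deriv (by simp)
  have key := image_le_of_deriv_right_le_deriv_boundary (f := F) (f' := g) (a := x) (b := x + 1)
    (fun t ht => (hF t ht).continuousAt.continuousWithinAt)
    (fun t ht => (hF t ⟨ht.1, ht.2.le⟩).hasDerivWithinAt)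
    (B := B) (by simp [B]) (fun t _ => (hB t).continuousAt.continuousWithinAt)
    (fun t _ => (hB t).hasDerivWithinAt)
    (fun t ht => by
      have h := hg.2 (Set.left_mem_Icc.2 (by linarith : x ≤ x + 1))
        (Set.right_mem_Icc.2 (by linarith : x ≤ x + 1))
        (by linarith [ht.2] : 0 ≤ x + 1 - t) (by linarith [ht.1] : 0 ≤ t - x) (by ring)
      simp only [smul_eq_mul] at h
      have e : (x + 1 - t) * x + (t - x) * (x + 1) = t := by ring
      rw [e] at h
      linarith)
    (x := x + 1) ⟨by linarith, le_refl _⟩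
  simp only [B] at key
  ring_nf at key ⊢
  linarith

lemma sub_le_of_deriv_le {F g : ℝ → ℝ} {x m : ℝ}
    (hF : ∀ t ∈ Set.Icc x (x + 1), HasDerivAt F (g t) t) (hg : ∀ t ∈ Set.Icc x (x + 1), g t ≤ m) :
    F (x + 1) - F x ≤ m := by
  obtain ⟨c, hc, h⟩ := exists_hasDerivAt_eq_slope F g (a := x) (b := x + 1) (by linarith)
    (fun t ht => (hF t ht).continuousAt.continuousWithinAt)
    (fun t ht => hF t ⟨ht.1.le, ht.2.le⟩)
  have := hg c ⟨hc.1.le, hc.2.le⟩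
  rw [h] at this
  simpa using this

lemma hasDerivAt_rpow_of_pos {t : ℝ} (ht : 0 < t) (p : ℝ) :
    HasDerivAt (fun t : ℝ => t ^ p) (p * t ^ (p - 1)) t :=
  Real.hasDerivAt_rpow_const (Or.inl ht.ne')

lemma convexOn_rpow_neg_Ioi {α : ℝ} (hα : 0 ≤ α) :
    ConvexOn ℝ (Set.Ioi 0) fun x : ℝ => x ^ (-α) := by
  have hd : ∀ t ∈ Set.Ioi (0 : ℝ), HasDerivAt (fun x : ℝ => x ^ (-α)) (-α * t ^ (-α - 1)) t :=
    fun t ht => hasDerivAt_rpow_of_pos ht _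
  refine MonotoneOn.convexOn_of_deriv (convex_Ioi 0)
    (fun t ht => (hd t ht).continuousAt.continuousWithinAt) ?_ ?_
  · rw [interior_Ioi]
    exact fun t ht => (hd t ht).differentiableAt.differentiableWithinAt
  · rw [interior_Ioi]
    intro s hs t ht hst
    rw [(hd s hs).deriv, (hd t ht).deriv]
    have := Real.rpow_le_rpow_of_nonpos hs hst (z := -α - 1) (by linarith)
    nlinarith

/-- The defect of the trapezoidal rule for `t ↦ t ^ (1 - α)` on `[x, x + 1]`. -/
noncomputable def trapezoidDefect (α x : ℝ) : ℝ :=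
  ((x + 1) ^ (2 - α) - x ^ (2 - α)) / (2 - α) - ((x + 1) ^ (1 - α) + x ^ (1 - α)) / 2

lemma hasDerivAt_rpow_two_sub_div {α t : ℝ} (hα : α < 1) (ht : 0 < t) :
    HasDerivAt (fun t : ℝ => t ^ (2 - α) / (2 - α)) (t ^ (1 - α)) t := by
  have h := (hasDerivAt_rpow_of_pos ht (2 - α)).div_const (2 - α)
  have e : (2 - α) * t ^ (2 - α - 1) / (2 - α) = t ^ (1 - α) := by
    rw [mul_div_cancel_left₀ _ (by linarith)]
    congr 1; ring
  rwa [e] at h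

lemma hasDerivAt_rpow_one_sub {α t : ℝ} (ht : 0 < t) :
    HasDerivAt (fun t : ℝ => t ^ (1 - α)) ((1 - α) * t ^ (-α)) t := by
  have h := hasDerivAt_rpow_of_pos ht (1 - α)
  rwa [show 1 - α - 1 = -α by ring] at h

lemma trapezoidDefect_nonneg {α x : ℝ} (h0 : 0 < α) (h1 : α < 1) (hx : 0 < x) :
    0 ≤ trapezoidDefect α x := by
  have h := sub_le_average_of_convexOn_deriv (F := fun t => -(t ^ (2 - α) / (2 - α)))
    (g := fun t => -(t ^ (1 - α))) (x := x)
    (fun t ht => (hasDerivAt_rpow_two_sub_div h1 (by linarith [ht.1])).neg)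
    (((Real.concaveOn_rpow (p := 1 - α) (by linarith) (by linarith)).subset
      (fun t ht => by simp only [Set.mem_Ici]; linarith [ht.1]) (convex_Icc _ _)).neg)
  rw [trapezoidDefect, sub_div]
  linarith

lemma rpow_one_sub_sub_le_average {α x : ℝ} (h0 : 0 < α) (h1 : α < 1) (hx : 0 < x) :
    (x + 1) ^ (1 - α) - x ^ (1 - α) ≤ (1 - α) / 2 * ((x + 1) ^ (-α) + x ^ (-α)) := by
  have h := sub_le_average_of_convexOn_deriv (F := fun t => t ^ (1 - α))
    (g := fun t => (1 - α) * t ^ (-α)) (x := x)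
    (fun t ht => hasDerivAt_rpow_one_sub (by linarith [ht.1]))
    (((convexOn_rpow_neg_Ioi h0.le).subset
      (fun t ht => by simp only [Set.mem_Ioi]; linarith [ht.1]) (convex_Icc _ _)).smul
      (c := 1 - α) (by linarith))
  linarith

lemma rpow_one_sub_sub_le {α x : ℝ} (h0 : 0 < α) (h1 : α < 1) (hx : 0 < x) :
    (x + 1) ^ (1 - α) - x ^ (1 - α) ≤ (1 - α) * x ^ (-α) :=
  sub_le_of_deriv_le (F := fun t => t ^ (1 - α)) (g := fun t => (1 - α) * t ^ (-α))
    (fun t ht => hasDerivAt_rpow_one_sub (by linarith [ht.1]))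
    (fun t ht => mul_le_mul_of_nonneg_left
      (Real.rpow_le_rpow_of_nonpos hx ht.1 (by linarith)) (by linarith))

lemma le_rpow_one_sub_sub {α x : ℝ} (h0 : 0 < α) (h1 : α < 1) (hx : 0 < x) :
    (1 - α) * (x + 1) ^ (-α) ≤ (x + 1) ^ (1 - α) - x ^ (1 - α) := by
  have h := sub_le_of_deriv_le (F := fun t => -(t ^ (1 - α)))
    (g := fun t => -((1 - α) * t ^ (-α))) (x := x) (m := -((1 - α) * (x + 1) ^ (-α)))
    (fun t ht => (hasDerivAt_rpow_one_sub (by linarith [ht.1])).neg)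
    (fun t ht => neg_le_neg (mul_le_mul_of_nonneg_left
      (Real.rpow_le_rpow_of_nonpos (by linarith [ht.1]) ht.2 (by linarith)) (by linarith)))
  linarith

lemma trapezoidDefect_le {α x : ℝ} (h1 : α < 1) (hx : 0 < x) :
    trapezoidDefect α x ≤ ((x + 1) ^ (1 - α) - x ^ (1 - α)) / 2 := by
  have h := sub_le_of_deriv_le (F := fun t => t ^ (2 - α) / (2 - α)) (x := x)
    (g := fun t => t ^ (1 - α)) (m := (x + 1) ^ (1 - α))
    (fun t ht => hasDerivAt_rpow_two_sub_div h1 (by linarith [ht.1]))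
    (fun t ht => Real.rpow_le_rpow (by linarith [ht.1]) ht.2 (by linarith))
  rw [trapezoidDefect, sub_div]
  linarith

lemma hasDerivAt_trapezoidDefect {α x : ℝ} (h1 : α < 1) (hx : 0 < x) :
    HasDerivAt (trapezoidDefect α)
      ((x + 1) ^ (1 - α) - x ^ (1 - α) -
        ((1 - α) * (x + 1) ^ (-α) + (1 - α) * x ^ (-α)) / 2) x := by
  have hx' : 0 < x + 1 := by linarith
  have h := (((hasDerivAt_rpow_two_sub_div h1 hx').comp_add_const x 1).sub
    (hasDerivAt_rpow_two_sub_div h1 hx)).sub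
    ((((hasDerivAt_rpow_one_sub (α := α) hx').comp_add_const x 1).add
      (hasDerivAt_rpow_one_sub (α := α) hx)).div_const 2)
  refine h.congr_of_eventuallyEq (Filter.Eventually.of_forall fun t => ?_)
  simp only [trapezoidDefect, Pi.sub_apply, Pi.add_apply]
  ring

lemma antitoneOn_trapezoidDefect {α : ℝ} (h0 : 0 < α) (h1 : α < 1) :
    AntitoneOn (trapezoidDefect α) (Set.Ioi 0) := by
  refine antitoneOn_of_hasDerivWithinAt_nonpos (convex_Ioi 0)
    (fun t ht => (hasDerivAt_trapezoidDefect h1 ht).continuousAt.continuousWithinAt)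
    (fun t ht => (hasDerivAt_trapezoidDefect h1
      (by rwa [interior_Ioi] at ht)).hasDerivWithinAt) (fun t ht => ?_)
  rw [interior_Ioi] at ht
  linarith [rpow_one_sub_sub_le_average h0 h1 ht]

lemma antitoneOn_rpow_sub_sub_trapezoidDefect {α : ℝ} (h0 : 0 < α) (h1 : α < 1) :
    AntitoneOn (fun x => (x + 1) ^ (1 - α) - x ^ (1 - α) - trapezoidDefect α x) (Set.Ioi 0) := by
  have hd : ∀ t ∈ Set.Ioi (0 : ℝ), HasDerivAt
      (fun x => (x + 1) ^ (1 - α) - x ^ (1 - α) - trapezoidDefect α x)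
      ((1 - α) * (t + 1) ^ (-α) - (1 - α) * t ^ (-α) - ((t + 1) ^ (1 - α) - t ^ (1 - α) -
        ((1 - α) * (t + 1) ^ (-α) + (1 - α) * t ^ (-α)) / 2)) t := fun t ht =>
    (((hasDerivAt_rpow_one_sub (α := α)
      (show 0 < t + 1 by linarith [show (0 : ℝ) < t from ht])).comp_add_const t 1).sub
      (hasDerivAt_rpow_one_sub (α := α) ht)).sub (hasDerivAt_trapezoidDefect h1 ht)
  refine antitoneOn_of_hasDerivWithinAt_nonpos (convex_Ioi 0)
    (fun t ht => (hd t ht).continuousAt.continuousWithinAt)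
    (fun t ht => (hd t (by rwa [interior_Ioi] at ht)).hasDerivWithinAt) (fun t ht => ?_)
  rw [interior_Ioi] at ht
  have ha := le_rpow_one_sub_sub h0 h1 ht
  have hb : (1 - α) * (t + 1) ^ (-α) ≤ (1 - α) * t ^ (-α) :=
    mul_le_mul_of_nonneg_left
      (Real.rpow_le_rpow_of_nonpos ht (by linarith) (by linarith)) (by linarith)
  linarith

lemma le_sum_mul_sub_add {w G : ℕ → ℝ} {n : ℕ} (hw : ∀ s < n, w s ≤ w (s + 1))
    (hG : ∀ s ≤ n, 0 ≤ G s) :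
    w 0 * G 0 ≤ ∑ s ∈ range (n + 1), w s * (G s - G (s + 1)) + w n * G (n + 1) := by
  induction n with
  | zero => simp; linarith
  | succ n ih =>
    have h := ih (fun s hs => hw s (by omega)) (fun s hs => hG s (by omega))
    rw [sum_range_succ]
    have := mul_nonneg (sub_nonneg.2 (hw n (by omega))) (hG (n + 1) le_rfl)
    linarith

lemma le_of_sum_mul_sub_le {w E : ℕ → ℝ} {n : ℕ} {K : ℝ} (hw : ∀ s < n, w s ≤ w (s + 1))
    (hn : 0 < w n) (hE : ∀ s ≤ n, E s ≤ E 0 + K)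
    (h : ∑ s ∈ range (n + 1), w s * (E (s + 1) - E s) ≤ w 0 * K) : E (n + 1) ≤ E 0 + K := by
  have key := le_sum_mul_sub_add (w := w) (G := fun s => E 0 + K - E s) hw
    (fun s hs => by linarith [hE s hs])
  have e : ∑ s ∈ range (n + 1), w s * ((E 0 + K - E s) - (E 0 + K - E (s + 1))) =
      ∑ s ∈ range (n + 1), w s * (E (s + 1) - E s) :=
    sum_congr rfl fun s _ => by ring
  rw [e] at key
  have : 0 ≤ w n * (E 0 + K - E (n + 1)) := by linarith
  linarith [nonneg_of_mul_nonneg_right this hn]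

/-- Discrete version of `v ∂ₜ^α v ≥ ½ ∂ₜ^α v²`. -/
lemma half_sum_sq_sub_sq_le {σ : ℝ} {w v : ℕ → ℝ} {n : ℕ} (hσ0 : 0 ≤ σ) (hσ1 : σ ≤ 1)
    (hw0 : 0 ≤ w 0) (hw : ∀ s < n, w s ≤ w (s + 1))
    (hlast : ∀ m, n = m + 1 → σ * w m ≤ (2 * σ - 1) * w n)
    (hσ : 0 ≤ 2 * σ - 1) :
    (∑ s ∈ range (n + 1), w s * (v (s + 1) ^ 2 - v s ^ 2)) / 2 ≤
      (σ * v (n + 1) + (1 - σ) * v n) * ∑ s ∈ range (n + 1), w s * (v (s + 1) - v s) := by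
  rw [sum_range_succ, sum_range_succ]
  set d := v (n + 1) - v n with hd
  have e : v (n + 1) = v n + d := by rw [hd]; ring
  let Q : ℕ → ℝ := fun s => (v n - v s + σ * d) ^ 2 / 2
  have hterm : ∑ s ∈ range n, w s * (Q s - Q (s + 1)) =
      (σ * v (n + 1) + (1 - σ) * v n) * ∑ s ∈ range n, w s * (v (s + 1) - v s) -
        (∑ s ∈ range n, w s * (v (s + 1) ^ 2 - v s ^ 2)) / 2 := by
    rw [mul_sum, sum_div, ← sum_sub_distrib]
    refine sum_congr rfl fun s _ => ?_
    simp only [Q]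
    rw [e]
    ring
  have hmain : 0 ≤ ∑ s ∈ range n, w s * (Q s - Q (s + 1)) + (σ - 1 / 2) * w n * d ^ 2 := by
    have hQ : ∀ s, 0 ≤ Q s := fun s => by positivity
    cases n with
    | zero =>
      simp only [range_zero, sum_empty, zero_add]
      exact mul_nonneg (mul_nonneg (by linarith) hw0) (sq_nonneg _)
    | succ m =>
      have h := le_sum_mul_sub_add (w := w) (G := Q) (n := m)
        (fun s hs => hw s (by omega)) (fun s _ => hQ s)
      have h0 := mul_nonneg hw0 (hQ 0)
      have hm : 0 ≤ w m := by
        have : ∀ k ≤ m, 0 ≤ w k := by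
          intro k
          induction k with
          | zero => exact fun _ => hw0
          | succ k ih => exact fun hk => (ih (by omega)).trans (hw k (by omega))
        exact this m le_rfl
      have h1 := hlast m rfl
      have h2 : Q (m + 1) = σ ^ 2 * d ^ 2 / 2 := by simp only [Q]; ring
      have h3 : σ ^ 2 * w m ≤ (2 * σ - 1) * w (m + 1) := by
        have := mul_nonneg (mul_nonneg hσ0 (sub_nonneg.2 hσ1)) hm
        nlinarith
      have h4 := mul_nonneg (sub_nonneg.2 h3) (sq_nonneg d)
      rw [h2] at h
      linarith
  have e2 : (σ * v (n + 1) + (1 - σ) * v n) * d - (v (n + 1) ^ 2 - v n ^ 2) / 2 =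
      (σ - 1 / 2) * d ^ 2 := by
    rw [e]; ring
  have e3 := congrArg (w n * ·) e2
  linarith

lemma sum_Ioo_zero_succ (n : ℕ) (f : ℕ → ℝ) :
    ∑ i ∈ Ioo 0 (n + 1), f i = ∑ i ∈ range n, f (i + 1) := by
  rw [range_eq_Ico, sum_Ico_add' f 0 n 1]
  rfl

lemma sum_secondDiff_mul (w : ℕ → ℝ) (n : ℕ) :
    ∑ i ∈ range n, (w (i + 2) - 2 * w (i + 1) + w i) * w (i + 1) =
      -∑ i ∈ range (n + 1), (w (i + 1) - w i) ^ 2 + (w (n + 1) - w n) * w (n + 1) -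
        (w 1 - w 0) * w 0 := by
  induction n with
  | zero => simp; ring
  | succ n ih => rw [sum_range_succ, ih, sum_range_succ _ (n + 1)]; ring

lemma sum_secondDiff_sq_le (w : ℕ → ℝ) (n : ℕ) :
    ∑ i ∈ range n, (w (i + 2) - 2 * w (i + 1) + w i) ^ 2 + 2 * (w (n + 1) - w n) ^ 2 ≤
      4 * ∑ i ∈ range (n + 1), (w (i + 1) - w i) ^ 2 := by
  induction n with
  | zero => simp; nlinarith [sq_nonneg (w 1 - w 0)]
  | succ n ih =>
    rw [sum_range_succ, sum_range_succ _ (n + 1)]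
    nlinarith [sq_nonneg (w (n + 2) - w n)]

lemma sum_secondDiff_mul_average_le {w : ℕ → ℝ} {n : ℕ} (h0 : w 0 = 0) (hn : w (n + 1) = 0) :
    ∑ i ∈ range n, (w (i + 2) - 2 * w (i + 1) + w i) * ((w i + 10 * w (i + 1) + w (i + 2)) / 12) ≤
      -(2 / 3) * ∑ i ∈ range (n + 1), (w (i + 1) - w i) ^ 2 := by
  have h1 := sum_secondDiff_mul w n
  have h2 := sum_secondDiff_sq_le w n
  have e : ∑ i ∈ range n,
      (w (i + 2) - 2 * w (i + 1) + w i) * ((w i + 10 * w (i + 1) + w (i + 2)) / 12) =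
      ∑ i ∈ range n, (w (i + 2) - 2 * w (i + 1) + w i) * w (i + 1) +
        (∑ i ∈ range n, (w (i + 2) - 2 * w (i + 1) + w i) ^ 2) / 12 := by
    rw [sum_div, ← sum_add_distrib]
    exact sum_congr rfl fun i _ => by ring
  rw [e, h1, h0, hn]
  have := sq_nonneg (w (n + 1) - w n)
  linarith

lemma sq_le_mul_sum_sq_sub {w : ℕ → ℝ} {n i : ℕ} (h0 : w 0 = 0) (hi : i ≤ n) :
    w i ^ 2 ≤ i * ∑ r ∈ range n, (w (r + 1) - w r) ^ 2 := by
  have h := sq_sum_le_card_mul_sum_sq (s := range i) (f := fun r => w (r + 1) - w r)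
  rw [sum_range_sub, h0, sub_zero, card_range] at h
  refine h.trans (mul_le_mul_of_nonneg_left ?_ (Nat.cast_nonneg _))
  exact sum_le_sum_of_subset_of_nonneg (range_mono hi) fun _ _ _ => sq_nonneg _

lemma sum_average_sq_le {w : ℕ → ℝ} {n : ℕ} (h0 : w 0 = 0) :
    ∑ i ∈ range n, ((w i + 10 * w (i + 1) + w (i + 2)) / 12) ^ 2 ≤
      2 / 3 * ((n : ℝ) + 1) ^ 2 * ∑ i ∈ range (n + 1), (w (i + 1) - w i) ^ 2 := by
  set S := ∑ i ∈ range (n + 1), (w (i + 1) - w i) ^ 2 with hS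
  have hS0 : 0 ≤ S := sum_nonneg fun _ _ => sq_nonneg _
  have hle : ∀ i ∈ range n, ((w i + 10 * w (i + 1) + w (i + 2)) / 12) ^ 2 ≤ ((i : ℝ) + 1) * S := by
    intro i hi
    rw [mem_range] at hi
    have a := sq_le_mul_sum_sq_sub (n := n + 1) (i := i) h0 (by omega)
    have b := sq_le_mul_sum_sq_sub (n := n + 1) (i := i + 1) h0 (by omega)
    have c := sq_le_mul_sum_sq_sub (n := n + 1) (i := i + 2) h0 (by omega)
    rw [← hS] at a b c
    push_cast at a b c
    nlinarith [sq_nonneg (w i - w (i + 1)), sq_nonneg (w i - w (i + 2)),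
      sq_nonneg (w (i + 1) - w (i + 2))]
  refine (sum_le_sum hle).trans ?_
  rw [← sum_mul]
  refine mul_le_mul_of_nonneg_right ?_ hS0
  have : ∀ m : ℕ, ∑ i ∈ range m, ((i : ℝ) + 1) = m * (m + 1) / 2 := by
    intro m
    induction m with
    | zero => simp
    | succ m ih => rw [sum_range_succ, ih]; push_cast; ring
  rw [this]
  nlinarith [Nat.cast_nonneg (α := ℝ) n]

lemma aCoef_succ (α σ : ℝ) (m : ℕ) :
    aCoef α σ (m + 1) = (m + σ + 1) ^ (1 - α) - (m + σ) ^ (1 - α) := by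
  rw [aCoef, if_neg (Nat.succ_ne_zero m)]
  push_cast
  congr 2 <;> ring

lemma bCoef_succ (α σ : ℝ) (m : ℕ) : bCoef α σ (m + 1) = trapezoidDefect α (m + σ) := by
  have e1 : ((m + 1 : ℕ) : ℝ) + σ = m + σ + 1 := by push_cast; ring
  have e2 : ((m + 1 : ℕ) : ℝ) - 1 + σ = m + σ := by push_cast; ring
  rw [bCoef, trapezoidDefect, e1, e2]

section Coefficients

variable {α σ : ℝ} (h0 : 0 < α) (h1 : α < 1)

include h0 h1

lemma bCoef_succ_nonneg (hσ : 0 < σ) (m : ℕ) : 0 ≤ bCoef α σ (m + 1) := by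
  rw [bCoef_succ]
  exact trapezoidDefect_nonneg h0 h1 (by positivity)

lemma bCoef_succ_succ_le (hσ : 0 < σ) (m : ℕ) : bCoef α σ (m + 2) ≤ bCoef α σ (m + 1) := by
  rw [bCoef_succ α σ m, bCoef_succ α σ (m + 1)]
  have hm : 0 < (m : ℝ) + σ := by positivity
  push_cast
  exact antitoneOn_trapezoidDefect h0 h1 hm (show (0 : ℝ) < m + 1 + σ by linarith) (by linarith)

lemma aCoef_sub_bCoef_succ_le (hσ : 0 < σ) (m : ℕ) :
    aCoef α σ (m + 2) - bCoef α σ (m + 2) ≤ aCoef α σ (m + 1) - bCoef α σ (m + 1) := by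
  rw [bCoef_succ α σ m, bCoef_succ α σ (m + 1), aCoef_succ α σ m, aCoef_succ α σ (m + 1)]
  have hm : 0 < (m : ℝ) + σ := by positivity
  push_cast
  exact antitoneOn_rpow_sub_sub_trapezoidDefect h0 h1 hm
    (show (0 : ℝ) < m + 1 + σ by linarith) (by linarith)

lemma le_aCoef_succ (hσ : 0 < σ) (m : ℕ) :
    (1 - α) * (((m + 1 : ℕ) : ℝ) + σ) ^ (-α) ≤ aCoef α σ (m + 1) := by
  rw [aCoef_succ, show ((m + 1 : ℕ) : ℝ) + σ = m + σ + 1 by push_cast; ring]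
  exact le_rpow_one_sub_sub h0 h1 (by positivity)

lemma aCoef_succ_nonneg (hσ : 0 < σ) (m : ℕ) : 0 ≤ aCoef α σ (m + 1) :=
  (mul_nonneg (by linarith) (by positivity)).trans (le_aCoef_succ h0 h1 hσ m)

lemma le_aCoef_sub_bCoef_succ (hσ : 0 < σ) (m : ℕ) :
    (1 - α) / 2 * (((m + 1 : ℕ) : ℝ) + σ) ^ (-α) ≤ aCoef α σ (m + 1) - bCoef α σ (m + 1) := by
  have ha := le_aCoef_succ h0 h1 hσ m
  have hb := trapezoidDefect_le (α := α) h1 (show 0 < (m : ℝ) + σ by positivity)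
  rw [← bCoef_succ, ← aCoef_succ] at hb
  linarith

lemma mul_aCoef_one_le (hσ : 0 < σ) : σ * aCoef α σ 1 ≤ (1 - α) * aCoef α σ 0 := by
  have h := rpow_one_sub_sub_le h0 h1 hσ
  have e := aCoef_succ α σ 0
  simp only [Nat.cast_zero, zero_add] at e
  have e' : aCoef α σ 0 = σ * σ ^ (-α) := by
    rw [aCoef, if_pos rfl, sub_eq_add_neg, Real.rpow_add hσ, Real.rpow_one]
  rw [← e] at h
  have h' := mul_le_mul_of_nonneg_left h hσ.le
  rw [e']
  linarith

end Coefficients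

lemma cCoef_zero_of_pos {α σ τ : ℝ} {lam : ℝ → ℝ} {j : ℕ} (hj : 0 < j) :
    cCoef α σ τ lam j 0 =
      lam ((σ - 1 / 2) * τ) * aCoef α σ 0 + lam (σ * τ) * bCoef α σ 1 := by
  simp [cCoef, hj.ne']

lemma cCoef_last {α σ τ : ℝ} {lam : ℝ → ℝ} {j : ℕ} (hj : 0 < j) :
    cCoef α σ τ lam j j =
      lam (((j : ℝ) + σ - 1 / 2) * τ) * aCoef α σ j - lam (((j : ℝ) + σ) * τ) * bCoef α σ j := by
  simp [cCoef, hj.ne']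

lemma cCoef_interior {α σ τ : ℝ} {lam : ℝ → ℝ} {j s : ℕ} (hs : 0 < s) (hj : s < j) :
    cCoef α σ τ lam j s =
      lam (((s : ℝ) + σ - 1 / 2) * τ) * aCoef α σ s + lam (((s : ℝ) + σ) * τ) * bCoef α σ (s + 1) -
        lam (((s : ℝ) + σ) * τ) * bCoef α σ s := by
  rw [cCoef, if_neg (by omega), if_neg hs.ne', if_neg hj.ne]

section WeightedCoefficients

variable {α σ τ T : ℝ} {lam : ℝ → ℝ} {j : ℕ} (h0 : 0 < α) (h1 : α < 1) (hσ : σ = 1 - α / 2)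
  (hτ : 0 < τ) (hpos : ∀ t ∈ Set.Icc (0 : ℝ) T, 0 < lam t)
  (hanti : AntitoneOn lam (Set.Icc 0 T)) (hj : ((j : ℝ) + σ) * τ ≤ T)

include hτ hj in
lemma mul_mem_Icc_of_le {x : ℝ} (hx0 : 0 ≤ x) (hx : x ≤ j + σ) : x * τ ∈ Set.Icc 0 T :=
  ⟨by positivity, (mul_le_mul_of_nonneg_right hx hτ.le).trans hj⟩

include hτ hanti hj in
lemma antitone_sample {x z : ℝ} (hx0 : 0 ≤ x) (hxz : x ≤ z) (hz : z ≤ j + σ) :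
    lam (z * τ) ≤ lam (x * τ) :=
  hanti (mul_mem_Icc_of_le hτ hj hx0 (hxz.trans hz))
    (mul_mem_Icc_of_le hτ hj (hx0.trans hxz) hz) (mul_le_mul_of_nonneg_right hxz hτ.le)

include h0 h1 hσ hτ hpos hanti hj

lemma cCoef_succ_le {m : ℕ} (hm : m + 1 ≤ j) :
    cCoef α σ τ lam j (m + 1) ≤ lam (((m : ℝ) + σ) * τ) * aCoef α σ (m + 1) := by
  have hσ0 : 0 < σ := by linarith
  have hmj : (m : ℝ) + 1 ≤ j := by exact_mod_cast hm
  have hm0 : (0 : ℝ) ≤ m := Nat.cast_nonneg m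
  have hs := antitone_sample hτ hanti hj (x := m + σ)
    (z := ((m + 1 : ℕ) : ℝ) + σ - 1 / 2) (by linarith) (by push_cast; linarith)
    (by push_cast; linarith)
  have hp := hpos _ (mul_mem_Icc_of_le hτ hj (x := ((m + 1 : ℕ) : ℝ) + σ)
    (by push_cast; linarith) (by push_cast; linarith))
  have ha := mul_le_mul_of_nonneg_right hs (aCoef_succ_nonneg h0 h1 hσ0 m)
  rcases hm.eq_or_lt with rfl | hlt
  · rw [cCoef_last (Nat.succ_pos m)]
    have := mul_nonneg hp.le (bCoef_succ_nonneg h0 h1 hσ0 m)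
    linarith
  · rw [cCoef_interior (Nat.succ_pos m) hlt]
    have := mul_le_mul_of_nonneg_left (bCoef_succ_succ_le h0 h1 hσ0 m) hp.le
    linarith

lemma cCoef_succ_succ_le {m : ℕ} (hm : m + 2 ≤ j) :
    cCoef α σ τ lam j (m + 2) ≤ cCoef α σ τ lam j (m + 1) := by
  have hσ0 : 0 < σ := by linarith
  have hmj : (m : ℝ) + 2 ≤ j := by exact_mod_cast hm
  have hm0 : (0 : ℝ) ≤ m := Nat.cast_nonneg m
  have hu := cCoef_succ_le h0 h1 hσ hτ hpos hanti hj (m := m + 1) hm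
  have hs := antitone_sample hτ hanti hj (x := ((m + 1 : ℕ) : ℝ) + σ - 1 / 2)
    (z := ((m + 1 : ℕ) : ℝ) + σ) (by push_cast; linarith) (by linarith) (by push_cast; linarith)
  have hp := hpos _ (mul_mem_Icc_of_le hτ hj (x := ((m + 1 : ℕ) : ℝ) + σ)
    (by push_cast; linarith) (by push_cast; linarith))
  have ha := mul_le_mul_of_nonneg_right hs (aCoef_succ_nonneg h0 h1 hσ0 m)
  have hab := mul_le_mul_of_nonneg_left (aCoef_sub_bCoef_succ_le h0 h1 hσ0 m) hp.le
  rw [cCoef_interior (s := m + 1) (Nat.succ_pos m) (by omega)]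
  linarith

lemma le_cCoef_zero (hj0 : 0 < j) : lam (σ * τ) * aCoef α σ 0 ≤ cCoef α σ τ lam j 0 := by
  have hσ0 : 0 < σ := by linarith
  have hj1 : (0 : ℝ) ≤ j := Nat.cast_nonneg j
  have hs := antitone_sample hτ hanti hj (x := σ - 1 / 2) (z := σ)
    (by linarith) (by linarith) (by linarith)
  have hp := hpos _ (mul_mem_Icc_of_le hτ hj hσ0.le (by linarith))
  have hb := mul_nonneg hp.le (bCoef_succ_nonneg h0 h1 hσ0 0)
  have ha0 : 0 ≤ aCoef α σ 0 := by rw [aCoef, if_pos rfl]; positivity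
  have ha := mul_le_mul_of_nonneg_right hs ha0
  rw [cCoef_zero_of_pos hj0]
  simp only [zero_add] at hb
  linarith

lemma cCoef_zero_pos : 0 < cCoef α σ τ lam j 0 := by
  have hσ0 : 0 < σ := by linarith
  have hj1 : (0 : ℝ) ≤ j := Nat.cast_nonneg j
  have ha0 : 0 < aCoef α σ 0 := by rw [aCoef, if_pos rfl]; positivity
  rcases Nat.eq_zero_or_pos j with hj0 | hj0
  · rw [cCoef, if_pos hj0]
    exact mul_pos (hpos _ (mul_mem_Icc_of_le hτ hj (by linarith) (by linarith))) ha0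
  · exact (mul_pos (hpos _ (mul_mem_Icc_of_le hτ hj hσ0.le (by linarith))) ha0).trans_le
      (le_cCoef_zero h0 h1 hσ hτ hpos hanti hj hj0)

lemma mul_cCoef_one_le (hj0 : 0 < j) :
    σ * cCoef α σ τ lam j 1 ≤ (2 * σ - 1) * cCoef α σ τ lam j 0 := by
  have hσ0 : 0 < σ := by linarith
  have hj1 : (0 : ℝ) ≤ j := Nat.cast_nonneg j
  have hu := cCoef_succ_le h0 h1 hσ hτ hpos hanti hj (m := 0) hj0
  simp only [Nat.cast_zero, zero_add] at hu
  have hl := le_cCoef_zero h0 h1 hσ hτ hpos hanti hj hj0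
  have hp := hpos _ (mul_mem_Icc_of_le hτ hj hσ0.le (by linarith))
  have e : 2 * σ - 1 = 1 - α := by linarith
  calc σ * cCoef α σ τ lam j 1 ≤ σ * (lam (σ * τ) * aCoef α σ 1) :=
        mul_le_mul_of_nonneg_left hu hσ0.le
    _ = lam (σ * τ) * (σ * aCoef α σ 1) := by ring
    _ ≤ lam (σ * τ) * ((1 - α) * aCoef α σ 0) :=
        mul_le_mul_of_nonneg_left (mul_aCoef_one_le h0 h1 hσ0) hp.le
    _ = (2 * σ - 1) * (lam (σ * τ) * aCoef α σ 0) := by rw [e]; ring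
    _ ≤ _ := mul_le_mul_of_nonneg_left hl (by linarith)

lemma cCoef_succ_le_self {s : ℕ} (hs : s < j) :
    cCoef α σ τ lam j (s + 1) ≤ cCoef α σ τ lam j s := by
  cases s with
  | zero =>
    have hσ0 : 0 < σ := by linarith
    have h := mul_cCoef_one_le h0 h1 hσ hτ hpos hanti hj hs
    have hc := cCoef_zero_pos h0 h1 hσ hτ hpos hanti hj
    refine le_of_mul_le_mul_left (h.trans ?_) hσ0
    exact mul_le_mul_of_nonneg_right (by linarith) hc.le
  | succ m => exact cCoef_succ_succ_le h0 h1 hσ hτ hpos hanti hj hs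

lemma le_cCoef_last :
    lam T * ((1 - α) / 2 * ((j : ℝ) + σ) ^ (-α)) ≤ cCoef α σ τ lam j j := by
  have hσ0 : 0 < σ := by linarith
  have hj1 : (0 : ℝ) ≤ j := Nat.cast_nonneg j
  have hend : lam T ≤ lam (((j : ℝ) + σ) * τ) := by
    have hmem := mul_mem_Icc_of_le hτ hj (x := j + σ) (by positivity) le_rfl
    exact hanti hmem ⟨hmem.1.trans hj, le_rfl⟩ hj
  have hs := antitone_sample hτ hanti hj (x := (j : ℝ) + σ - 1 / 2) (z := j + σ)
    (by linarith) (by linarith) le_rfl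
  have hp := hpos _ (mul_mem_Icc_of_le hτ hj (x := j + σ) (by positivity) le_rfl)
  have hpw : 0 ≤ (1 - α) / 2 * ((j : ℝ) + σ) ^ (-α) :=
    mul_nonneg (by linarith) (by positivity)
  refine (mul_le_mul_of_nonneg_right hend hpw).trans ?_
  cases j with
  | zero =>
    have ha : (1 - α) / 2 * σ ^ (-α) ≤ aCoef α σ 0 := by
      rw [aCoef, if_pos rfl, sub_eq_add_neg 1 α, Real.rpow_add hσ0, Real.rpow_one]
      exact mul_le_mul_of_nonneg_right (by linarith) (by positivity)
    simp only [Nat.cast_zero, zero_add] at hs hp hpw ⊢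
    rw [cCoef, if_pos rfl]
    exact mul_le_mul hs ha hpw (hp.le.trans hs)
  | succ m =>
    rw [cCoef_last (Nat.succ_pos m)]
    have ha := mul_le_mul_of_nonneg_right hs (aCoef_succ_nonneg h0 h1 hσ0 m)
    have hb := mul_le_mul_of_nonneg_left (le_aCoef_sub_bCoef_succ h0 h1 hσ0 m) hp.le
    linarith

end WeightedCoefficients

lemma gridInner_self (n : ℕ) (u : ℕ → ℝ) :
    gridInner (n + 1) u u = (∑ i ∈ range n, u (i + 1) ^ 2) / ((n : ℝ) + 1) := by
  rw [gridInner, sum_Ioo_zero_succ, sum_div]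
  refine sum_congr rfl fun i _ => ?_
  push_cast
  ring

lemma gridInner_self_nonneg (N : ℕ) (u : ℕ → ℝ) : 0 ≤ gridInner N u u :=
  sum_nonneg fun i _ => mul_nonneg (mul_self_nonneg _) (by positivity)

lemma sum_mul_gridInner_sub_le {n j : ℕ} {κ σ k q c₁ : ℝ} {w f : ℕ → ℝ} {y : ℕ → ℕ → ℝ}
    (hκ : 0 ≤ κ) (hc₁ : 0 < c₁) (hk : c₁ ≤ k) (hq : 0 ≤ q)
    (hσ : 0 ≤ 2 * σ - 1) (hσ1 : σ ≤ 1)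
    (hw0 : 0 ≤ w 0) (hw : ∀ s < j, w s ≤ w (s + 1))
    (hlast : ∀ m, j = m + 1 → σ * w m ≤ (2 * σ - 1) * w j)
    {z : ℕ → ℝ} (hz : ∀ i, z i = σ * y (j + 1) i + (1 - σ) * y j i)
    (hz0 : z 0 = 0) (hzn : z (n + 1) = 0)
    (hs : ∀ i < n, κ * ∑ s ∈ range (j + 1), w s * (Hh (y (s + 1)) (i + 1) - Hh (y s) (i + 1)) =
      k * (z (i + 2) - 2 * z (i + 1) + z i) * ((n : ℝ) + 1) ^ 2 - q * Hh z (i + 1) +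
        Hh f (i + 1)) :
    κ * ∑ s ∈ range (j + 1), w s * (gridInner (n + 1) (Hh (y (s + 1))) (Hh (y (s + 1))) -
      gridInner (n + 1) (Hh (y s)) (Hh (y s))) ≤
      gridInner (n + 1) (Hh f) (Hh f) / (2 * c₁) := by
  have hHz : ∀ i, Hh z (i + 1) = (z i + 10 * z (i + 1) + z (i + 2)) / 12 := fun i => rfl
  have hpt : ∀ i ∈ range n,
      κ * ((∑ s ∈ range (j + 1), w s * (Hh (y (s + 1)) (i + 1) ^ 2 - Hh (y s) (i + 1) ^ 2)) / 2) ≤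
      k * ((n : ℝ) + 1) ^ 2 * ((z (i + 2) - 2 * z (i + 1) + z i) * Hh z (i + 1)) +
        c₁ * Hh z (i + 1) ^ 2 + Hh f (i + 1) ^ 2 / (4 * c₁) := by
    intro i hi
    have h1 := half_sum_sq_sub_sq_le (σ := σ) (w := w) (v := fun s => Hh (y s) (i + 1)) (n := j)
      (by linarith) hσ1 hw0 hw hlast hσ
    have e : σ * Hh (y (j + 1)) (i + 1) + (1 - σ) * Hh (y j) (i + 1) = Hh z (i + 1) := by
      simp only [Hh, hz]; ring
    rw [e] at h1
    have h2 := mul_le_mul_of_nonneg_left h1 hκ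
    have h3 : κ * (Hh z (i + 1) *
        ∑ s ∈ range (j + 1), w s * (Hh (y (s + 1)) (i + 1) - Hh (y s) (i + 1))) =
        Hh z (i + 1) * (k * (z (i + 2) - 2 * z (i + 1) + z i) * ((n : ℝ) + 1) ^ 2 -
          q * Hh z (i + 1) + Hh f (i + 1)) := by
      rw [← hs i (Finset.mem_range.1 hi)]; ring
    rw [h3] at h2
    have h4 := mul_nonneg hq (sq_nonneg (Hh z (i + 1)))
    have h5 : Hh z (i + 1) * Hh f (i + 1) ≤
        c₁ * Hh z (i + 1) ^ 2 + Hh f (i + 1) ^ 2 / (4 * c₁) := by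
      have e5 : c₁ * Hh z (i + 1) ^ 2 + Hh f (i + 1) ^ 2 / (4 * c₁) -
          Hh z (i + 1) * Hh f (i + 1) =
          (2 * c₁ * Hh z (i + 1) - Hh f (i + 1)) ^ 2 / (4 * c₁) := by
        field_simp; ring
      have : 0 ≤ (2 * c₁ * Hh z (i + 1) - Hh f (i + 1)) ^ 2 / (4 * c₁) := by positivity
      linarith
    linarith
  have hsum := sum_le_sum hpt
  simp only [sum_add_distrib, ← mul_sum, ← sum_div] at hsum
  have hA := sum_secondDiff_mul_average_le hz0 hzn
  have hB := sum_average_sq_le (n := n) hz0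
  simp only [← hHz] at hA hB
  set S := ∑ i ∈ range (n + 1), (z (i + 1) - z i) ^ 2 with hS
  have hS0 : 0 ≤ S := sum_nonneg fun _ _ => sq_nonneg _
  have hk0 : 0 ≤ k * ((n : ℝ) + 1) ^ 2 := mul_nonneg (by linarith) (by positivity)
  have hA' := mul_le_mul_of_nonneg_left hA hk0
  have hB' := mul_le_mul_of_nonneg_left hB hc₁.le
  have hkc := mul_nonneg (mul_nonneg (sub_nonneg.2 hk) (sq_nonneg ((n : ℝ) + 1))) hS0
  have hfin : κ * ((∑ i ∈ range n, ∑ s ∈ range (j + 1),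
      w s * (Hh (y (s + 1)) (i + 1) ^ 2 - Hh (y s) (i + 1) ^ 2)) / 2) ≤
      (∑ i ∈ range n, Hh f (i + 1) ^ 2) / (4 * c₁) := by linarith
  rw [sum_comm] at hfin
  simp only [← mul_sum, sum_sub_distrib] at hfin
  simp only [gridInner_self]
  have e : ∀ s, w s * ((∑ i ∈ range n, Hh (y (s + 1)) (i + 1) ^ 2) / ((n : ℝ) + 1) -
      (∑ i ∈ range n, Hh (y s) (i + 1) ^ 2) / ((n : ℝ) + 1)) =
      w s * (∑ i ∈ range n, Hh (y (s + 1)) (i + 1) ^ 2 - ∑ i ∈ range n, Hh (y s) (i + 1) ^ 2) /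
        ((n : ℝ) + 1) := fun s => by ring
  simp only [e, ← sum_div]
  have hn : (0 : ℝ) < (n : ℝ) + 1 := by positivity
  have h2 := div_le_div_of_nonneg_right (mul_le_mul_of_nonneg_left hfin (by norm_num : (0 : ℝ) ≤ 2))
    hn.le
  refine (le_of_eq ?_).trans (h2.trans (le_of_eq ?_))
  · ring
  · field_simp; ring

/-- Theorem 5 of the paper (unconditional stability of the compact scheme
(26)–(27)): any solution of the fourth-order compact scheme for the generalized
time-fractional diffusion equation with `k = k(t)`, `q = q(t)` satisfies
`‖H_h y^{j+1}‖₀² ≤ ‖H_h y^0‖₀² + (T^α Γ(1−α)/(λ(T)c₁)) max_m ‖H_h φ^{m+σ}‖₀²`. -/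
theorem statement15 (α σ T c₁ c₂ : ℝ) (hα : α ∈ Set.Ioo (0 : ℝ) 1) (hσ : σ = 1 - α / 2)
    (hT : 0 < T) (hc₁ : 0 < c₁)
    (lam k q : ℝ → ℝ)
    (hlam : ContDiffOn ℝ 2 lam (Set.Icc 0 T))
    (hlam_pos : ∀ t ∈ Set.Icc (0 : ℝ) T, 0 < lam t)
    (hlam_der : ∀ t ∈ Set.Icc (0 : ℝ) T, deriv lam t ≤ 0)
    (hk_cont : ContinuousOn k (Set.Icc 0 T))
    (hq_cont : ContinuousOn q (Set.Icc 0 T))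
    (hk : ∀ t ∈ Set.Icc (0 : ℝ) T, c₁ ≤ k t ∧ k t ≤ c₂)
    (hq : ∀ t ∈ Set.Icc (0 : ℝ) T, 0 ≤ q t)
    (N M : ℕ) (hN : 2 ≤ N) (hM : 1 ≤ M)
    (y φ : ℕ → ℕ → ℝ)  -- `y j i = y_i^j`; `φ j i = φ_i^{j+σ}`
    (hy_bc : ∀ j, j ≤ M → y j 0 = 0 ∧ y j N = 0)
    (hscheme : ∀ j, j < M → ∀ i, 0 < i → i < N →
      ((T / M) ^ (1 - α) / Real.Gamma (2 - α)) *
          ∑ s ∈ Finset.range (j + 1),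
            cCoef α σ (T / M) lam j (j - s) * ((Hh (y (s + 1)) i - Hh (y s) i) / (T / M)) =
        k (((j : ℝ) + σ) * (T / M)) *
            ((σ * y (j + 1) (i + 1) + (1 - σ) * y j (i + 1)) -
              2 * (σ * y (j + 1) i + (1 - σ) * y j i) +
              (σ * y (j + 1) (i - 1) + (1 - σ) * y j (i - 1))) / (1 / N) ^ 2 -
          q (((j : ℝ) + σ) * (T / M)) *
            Hh (fun i' => σ * y (j + 1) i' + (1 - σ) * y j i') i +
          Hh (φ j) i) :
    ∀ j, j < M →
      gridInner N (Hh (y (j + 1))) (Hh (y (j + 1))) ≤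
        gridInner N (Hh (y 0)) (Hh (y 0)) +
          (T ^ α * Real.Gamma (1 - α) / (lam T * c₁)) *
            (Finset.range M).sup' (Finset.nonempty_range_iff.mpr (by omega))
              (fun m => gridInner N (Hh (φ m)) (Hh (φ m))) := by
  obtain ⟨h0, h1⟩ := hα
  obtain ⟨n, rfl⟩ : ∃ n, N = n + 1 := ⟨N - 1, by omega⟩
  have hM0 : (0 : ℝ) < M := by exact_mod_cast hM
  have hτ : 0 < T / M := div_pos hT hM0
  have hanti : AntitoneOn lam (Set.Icc 0 T) := by
    refine antitoneOn_of_deriv_nonpos (convex_Icc 0 T) hlam.continuousOn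
      ((hlam.differentiableOn (by norm_num)).mono interior_subset) fun t ht => ?_
    exact hlam_der t (interior_subset ht)
  have hlamT : 0 < lam T := hlam_pos T ⟨hT.le, le_rfl⟩
  have hΓ : 0 < Real.Gamma (1 - α) := Real.Gamma_pos_of_pos (by linarith)
  have hΓ2 : Real.Gamma (2 - α) = (1 - α) * Real.Gamma (1 - α) := by
    rw [← Real.Gamma_add_one (by linarith)]
    congr 1; ring
  have hα1 : 0 < 1 - α := by linarith
  set τ := T / M with hτdef
  set R := (Finset.range M).sup' (Finset.nonempty_range_iff.mpr (by omega))
    (fun m => gridInner (n + 1) (Hh (φ m)) (Hh (φ m))) with hR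
  have hRle : ∀ m < M, gridInner (n + 1) (Hh (φ m)) (Hh (φ m)) ≤ R := fun m hm =>
    Finset.le_sup' (fun m => gridInner (n + 1) (Hh (φ m)) (Hh (φ m))) (Finset.mem_range.2 hm)
  have hR0 : 0 ≤ R := (gridInner_self_nonneg _ _).trans (hRle 0 hM)
  set K := T ^ α * Real.Gamma (1 - α) / (lam T * c₁) * R with hK
  have hK0 : 0 ≤ K := by positivity
  have hκ : 0 < τ ^ (1 - α) / Real.Gamma (2 - α) / τ := by rw [hΓ2]; positivity
  intro j
  induction j using Nat.strong_induction_on with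
  | _ j ih =>
  intro hjM
  have hjM' : (j : ℝ) + 1 ≤ M := by exact_mod_cast hjM
  have hj0 : (0 : ℝ) ≤ j := Nat.cast_nonneg j
  have hjσ : (j : ℝ) + σ ≤ M := by linarith
  have hj : ((j : ℝ) + σ) * τ ≤ T :=
    (mul_le_mul_of_nonneg_right hjσ hτ.le).trans_eq (by rw [hτdef]; field_simp)
  have hmem : ((j : ℝ) + σ) * τ ∈ Set.Icc 0 T := ⟨mul_nonneg (by linarith) hτ.le, hj⟩
  let w : ℕ → ℝ := fun s => cCoef α σ τ lam j (j - s)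
  have hw : ∀ s < j, w s ≤ w (s + 1) := fun s hs => by
    have h := cCoef_succ_le_self h0 h1 hσ hτ hlam_pos hanti hj (s := j - (s + 1)) (by omega)
    rwa [show j - (s + 1) + 1 = j - s by omega] at h
  have hwlast : 0 < w j := by
    simp only [w, Nat.sub_self]
    exact cCoef_zero_pos h0 h1 hσ hτ hlam_pos hanti hj
  have hwfirst : lam T * ((1 - α) / 2 * (τ ^ α / T ^ α)) ≤ w 0 := by
    refine le_trans ?_ (le_cCoef_last h0 h1 hσ hτ hlam_pos hanti hj)
    refine mul_le_mul_of_nonneg_left (mul_le_mul_of_nonneg_left ?_ (by linarith)) hlamT.le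
    rw [← Real.div_rpow hτ.le hT.le, show τ / T = (M : ℝ)⁻¹ by rw [hτdef]; field_simp,
      Real.inv_rpow hM0.le, ← Real.rpow_neg hM0.le]
    exact Real.rpow_le_rpow_of_nonpos (by linarith) hjσ (by linarith)
  have hw0 : 0 ≤ w 0 := le_trans (by positivity) hwfirst
  have henergy := sum_mul_gridInner_sub_le (n := n) (j := j) (w := w) (f := φ j) (y := y)
    (z := fun i => σ * y (j + 1) i + (1 - σ) * y j i) hκ.le hc₁ (hk _ hmem).1 (hq _ hmem)
    (by linarith) (by linarith) hw0 hw
    (fun m hm => by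
      have h := mul_cCoef_one_le h0 h1 hσ hτ hlam_pos hanti hj (by omega)
      simp only [w, Nat.sub_self]
      rwa [show j - m = 1 by omega])
    (fun _ => rfl)
    (by simp [(hy_bc j hjM.le).1, (hy_bc (j + 1) hjM).1])
    (by simp [(hy_bc j hjM.le).2, (hy_bc (j + 1) hjM).2])
    (fun i hi => by
      have h := hscheme j hjM (i + 1) (Nat.succ_pos i) (by omega)
      have e : ∑ s ∈ range (j + 1), cCoef α σ τ lam j (j - s) *
          ((Hh (y (s + 1)) (i + 1) - Hh (y s) (i + 1)) / τ) =
          (∑ s ∈ range (j + 1), w s * (Hh (y (s + 1)) (i + 1) - Hh (y s) (i + 1))) / τ := by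
        rw [sum_div]
        exact sum_congr rfl fun s _ => by simp only [w]; ring
      rw [e] at h
      rw [div_mul_eq_mul_div, mul_div_assoc, h, Nat.add_sub_cancel]
      push_cast
      field_simp)
  refine le_of_sum_mul_sub_le (w := w) (E := fun s => gridInner (n + 1) (Hh (y s)) (Hh (y s)))
    hw hwlast ?_ ?_
  · intro s hs
    cases s with
    | zero => linarith
    | succ s => exact ih s (by omega) (by omega)
  · refine le_trans ?_ (mul_le_mul_of_nonneg_right hwfirst hK0)
    refine le_of_mul_le_mul_left (henergy.trans ?_) hκ
    have hF : gridInner (n + 1) (Hh (φ j)) (Hh (φ j)) / (2 * c₁) ≤ R / (2 * c₁) :=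
      div_le_div_of_nonneg_right (hRle j hjM) (by positivity)
    refine hF.trans_eq ?_
    have hpow : τ ^ (1 - α) * τ ^ α = τ := by
      rw [← Real.rpow_add hτ]; simp
    have hTα : 0 < T ^ α := Real.rpow_pos_of_pos hT α
    calc R / (2 * c₁) = τ / τ * (R / (2 * c₁)) := by rw [div_self hτ.ne', one_mul]
      _ = τ ^ (1 - α) * τ ^ α / τ * (R / (2 * c₁)) := by rw [hpow]
      _ = _ := by
        rw [hK, hΓ2]
        field_simp
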